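/- arXiv:1102.3574 — 4 statements merged into one kernel-verified Lean document; each statement's English description precedes it below -/
import Mathlib

section
/- Let E be a real Hilbert space, let C ⊆ E be a nonempty closed convex set, and let g : E → E be an affine isometric equivalence with g(C) = C. Let x ∈ E and let p ∈ C satisfy dist x p = infDist x C. Define c : ℝ → E by c(t) = p + t • (x − p), and set h(t) = dist (c t) (g (c t)). Then h is convex on ℝ and monotone nondecreasing on [0, ∞); moreover, if h(t₀) > h(0) for some t₀ > 0, then h(t₁) > h(t₀) for every t₁ > t₀. -/
open scoped InnerProductSpace in
/-- A nearest point `p` of a convex set `C` to `x` satisfies the obtuse angle criterion. -/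
theorem inner_sub_sub_nonpos_of_dist_eq_infDist {E : Type*} [NormedAddCommGroup E]
    [InnerProductSpace ℝ E] {C : Set E} (hC : Convex ℝ C) {x p : E} (hp : p ∈ C)
    (hdist : dist x p = Metric.infDist x C) {w : E} (hw : w ∈ C) :
    ⟪x - p, w - p⟫_ℝ ≤ 0 := by
  refine (norm_eq_iInf_iff_real_inner_le_zero hC hp).1 ?_ w hw
  simpa only [Metric.infDist_eq_iInf, dist_eq_norm] using hdist

open scoped InnerProductSpace in
theorem norm_add_smul_sq_real {E : Type*} [NormedAddCommGroup E] [InnerProductSpace ℝ E]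
    (a b : E) (t : ℝ) : ‖a + t • b‖ ^ 2 = ‖a‖ ^ 2 + 2 * t * ⟪a, b⟫_ℝ + t ^ 2 * ‖b‖ ^ 2 := by
  rw [norm_add_sq_real, real_inner_smul_right, norm_smul, mul_pow, Real.norm_eq_abs, sq_abs]
  ring

theorem convexOn_norm_add_smul {E : Type*} [NormedAddCommGroup E] [NormedSpace ℝ E]
    (a b : E) : ConvexOn ℝ Set.univ fun t : ℝ => ‖a + t • b‖ := by
  have h := (convexOn_norm (E := E) convex_univ).comp_affineMap (AffineMap.lineMap a (a + b))
  simpa [Function.comp_def, AffineMap.lineMap_apply, add_comm] using h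

open scoped InnerProductSpace in
theorem monotoneOn_norm_add_smul {E : Type*} [NormedAddCommGroup E] [InnerProductSpace ℝ E]
    {a b : E} (hab : 0 ≤ ⟪a, b⟫_ℝ) : MonotoneOn (fun t : ℝ => ‖a + t • b‖) (Set.Ici 0) := by
  intro s hs t _ hst
  have hs : 0 ≤ s := hs
  refine (sq_le_sq₀ (norm_nonneg _) (norm_nonneg _)).1 ?_
  rw [norm_add_smul_sq_real, norm_add_smul_sq_real]
  gcongr

/-- The displacement of `g` has nonnegative derivative at `p` in the direction away from an
invariant convex set with nearest point `p` to `x`. -/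
theorem inner_displacement_nonneg {E : Type*} [NormedAddCommGroup E] [InnerProductSpace ℝ E]
    {C : Set E} (hC : Convex ℝ C) (g : E ≃ᵃⁱ[ℝ] E) (hgC : g '' C = C) {x p : E} (hp : p ∈ C)
    (hdist : dist x p = Metric.infDist x C) :
    0 ≤ inner ℝ (p - g p) ((x - p) - g.linearIsometryEquiv (x - p)) := by
  have hgp : g p ∈ C := hgC ▸ Set.mem_image_of_mem g hp
  obtain ⟨q, hq, hqp⟩ : p ∈ g '' C := hgC.symm ▸ hp
  have h₁ := inner_sub_sub_nonpos_of_dist_eq_infDist hC hp hdist hgp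
  have h₂ := inner_sub_sub_nonpos_of_dist_eq_infDist hC hp hdist hq
  have hL : p - g p = g.linearIsometryEquiv (q - p) := by
    have := g.map_vsub q p
    simp only [vsub_eq_sub, hqp] at this
    exact this.symm
  rw [inner_sub_right]
  have h₃ : inner ℝ (p - g p) (g.linearIsometryEquiv (x - p)) = inner ℝ (x - p) (q - p) := by
    rw [hL, LinearIsometryEquiv.inner_map_map, real_inner_comm]
  have h₄ : inner ℝ (p - g p) (x - p) = -inner ℝ (x - p) (g p - p) := by
    rw [← inner_neg_right, neg_sub, real_inner_comm]
  linarith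

/-- **Ray lemma (Hilbert-space form).** Let `C` be a nonempty closed convex subset of a
real Hilbert space `E`, let `g` be an affine isometric equivalence of `E` preserving `C`,
and let `p ∈ C` be a nearest point of `C` to `x`. Along the ray `c t = p + t • (x - p)`,
the displacement `h t = dist (c t) (g (c t))` is convex and nondecreasing on `[0, ∞)`;
moreover if `h t₀ > h 0` for some `t₀ > 0`, then `h t₁ > h t₀` for every `t₁ > t₀`. -/
theorem ray_lemma {E : Type*} [NormedAddCommGroup E] [InnerProductSpace ℝ E]
    [CompleteSpace E] (C : Set E) (hC_ne : C.Nonempty) (hC_closed : IsClosed C)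
    (hC_convex : Convex ℝ C) (g : E ≃ᵃⁱ[ℝ] E) (hgC : g '' C = C)
    (x p : E) (hp : p ∈ C) (hdist : dist x p = Metric.infDist x C)
    (c : ℝ → E) (hc : ∀ t : ℝ, c t = p + t • (x - p))
    (h : ℝ → ℝ) (hh : ∀ t : ℝ, h t = dist (c t) (g (c t))) :
    ConvexOn ℝ Set.univ h ∧ MonotoneOn h (Set.Ici (0 : ℝ)) ∧
      ∀ t₀ : ℝ, 0 < t₀ → h 0 < h t₀ → ∀ t₁ : ℝ, t₀ < t₁ → h t₀ < h t₁ := by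
  have hform : h = fun t : ℝ =>
      ‖(p - g p) + t • ((x - p) - g.linearIsometryEquiv (x - p))‖ := by
    funext t
    have hg : g (p + t • (x - p)) = t • g.linearIsometryEquiv (x - p) + g p := by
      have := g.map_vadd p (t • (x - p))
      rwa [vadd_eq_add, vadd_eq_add, map_smul, add_comm] at this
    rw [hh, hc, hg, dist_eq_norm]
    congr 1
    module
  have hconv : ConvexOn ℝ Set.univ h := hform ▸ convexOn_norm_add_smul _ _
  refine ⟨hconv, ?_, fun t₀ ht₀ hlt t₁ ht₁ => ?_⟩
  · rw [hform]
    exact monotoneOn_norm_add_smul (inner_displacement_nonneg hC_convex g hgC hp hdist)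
  · exact hconv.strictMonoOn (Set.mem_univ 0) ht₀ hlt ⟨Set.mem_univ _, Set.self_mem_Ici⟩
      ⟨Set.mem_univ _, ht₁.le⟩ ht₁
end

section
/- Let E be a real Hilbert space and let g₁, …, gₙ be pairwise commuting affine isometric equivalences of E. Let t₁, …, tₙ ≥ 0 be such that for each i the sublevel set {x ∈ E : dist x (gᵢ x) ≤ tᵢ} is nonempty. Then the intersection ⋂ᵢ {x ∈ E : dist x (gᵢ x) ≤ tᵢ} is nonempty. -/
section Displacement

variable {E : Type*} [NormedAddCommGroup E] [InnerProductSpace ℝ E]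

/-- The displacement function of an affine isometry is convex. -/
theorem AffineIsometryEquiv.convexOn_dist_self (g : E ≃ᵃⁱ[ℝ] E) :
    ConvexOn ℝ Set.univ (fun x => dist x (g x)) := by
  have h : (fun x => dist x (g x)) = norm ∘ (AffineMap.id ℝ E - (g.toAffineEquiv : E →ᵃ[ℝ] E)) := by
    ext x
    simp [dist_eq_norm]
  rw [h]
  exact convexOn_univ_norm.comp_affineMap _

theorem AffineIsometryEquiv.convex_setOf_dist_self_le (g : E ≃ᵃⁱ[ℝ] E) (t : ℝ) :
    Convex ℝ {x : E | dist x (g x) ≤ t} := by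
  simpa using g.convexOn_dist_self.convex_le t

theorem AffineIsometryEquiv.isClosed_setOf_dist_self_le (g : E ≃ᵃⁱ[ℝ] E) (t : ℝ) :
    IsClosed {x : E | dist x (g x) ≤ t} :=
  isClosed_le (continuous_id.dist g.continuous) continuous_const

theorem AffineIsometryEquiv.inner_map_sub_map_sub (f : E ≃ᵃⁱ[ℝ] E) (a b c d : E) :
    inner ℝ (f a - f b) (f c - f d) = inner ℝ (a - b) (c - d) := by
  have h (u v : E) : f u - f v = f.linearIsometryEquiv (u - v) := (f.map_vsub u v).symm
  rw [h, h, LinearIsometryEquiv.inner_map_map]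

/-- Projecting a point onto a nonempty closed convex set does not increase its displacement under
any affine isometry preserving the set. -/
theorem Convex.exists_mem_forall_dist_map_le [CompleteSpace E] {C : Set E} (hconv : Convex ℝ C)
    (hclosed : IsClosed C) (hne : C.Nonempty) (x : E) :
    ∃ p ∈ C, ∀ f : E ≃ᵃⁱ[ℝ] E, Set.MapsTo f C C → Set.MapsTo f.symm C C →
      dist p (f p) ≤ dist x (f x) := by
  obtain ⟨p, hp, hpx⟩ := exists_norm_eq_iInf_of_complete_convex hne hclosed.isComplete hconv x
  rw [norm_eq_iInf_iff_real_inner_le_zero hconv hp] at hpx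
  refine ⟨p, hp, fun f hf hf' => ?_⟩
  have h₁ : inner ℝ (x - p) (f p - p) ≤ 0 := hpx _ (hf hp)
  have h₂ : inner ℝ (f x - f p) (p - f p) ≤ 0 := by
    have h := hpx _ (hf' hp)
    rwa [← f.inner_map_sub_map_sub, f.apply_symm_apply] at h
  have h₃ : ‖p - f p‖ * ‖p - f p‖ ≤ inner ℝ (x - f x) (p - f p) := by
    have e : inner ℝ (x - f x) (p - f p) = ‖p - f p‖ * ‖p - f p‖
        - inner ℝ (x - p) (f p - p) - inner ℝ (f x - f p) (p - f p) := by
      rw [← real_inner_self_eq_norm_mul_norm, ← neg_sub p (f p), inner_neg_right, sub_neg_eq_add,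
        ← inner_add_left, ← inner_sub_left]
      congr 1
      abel
    linarith
  rw [dist_eq_norm, dist_eq_norm]
  rcases (norm_nonneg (p - f p)).eq_or_lt with h₀ | h₀
  · rw [← h₀]
    exact norm_nonneg _
  · exact le_of_mul_le_mul_right (h₃.trans (real_inner_le_norm _ _)) h₀

/-- An isometry commuting with `g` preserves the sublevel sets of the displacement of `g`. -/
theorem AffineIsometryEquiv.mapsTo_setOf_dist_self_le {f g : E ≃ᵃⁱ[ℝ] E}
    (h : Function.Commute (f : E → E) g) (t : ℝ) :
    Set.MapsTo f {x : E | dist x (g x) ≤ t} {x : E | dist x (g x) ≤ t} := by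
  intro x hx
  rwa [Set.mem_ofPred_eq, ← h x, f.dist_map]

end Displacement

/-- **Nonempty intersection of sublevel sets of commuting isometries (part (i)).**
If `g₁, …, gₙ` are pairwise commuting affine isometric equivalences of a real Hilbert
space `E` and `t₁, …, tₙ ≥ 0` are such that each sublevel set
`{x | dist x (gᵢ x) ≤ tᵢ}` is nonempty, then their intersection is nonempty. -/
theorem sublevel_sets_inter_nonempty {E : Type*} [NormedAddCommGroup E]
    [InnerProductSpace ℝ E] [CompleteSpace E] (n : ℕ) (g : Fin n → (E ≃ᵃⁱ[ℝ] E))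
    (hcomm : ∀ i j : Fin n, ((g i : E → E) ∘ (g j : E → E)) = ((g j : E → E) ∘ (g i : E → E)))
    (t : Fin n → ℝ) (ht : ∀ i, 0 ≤ t i)
    (hne : ∀ i, {x : E | dist x (g i x) ≤ t i}.Nonempty) :
    (⋂ i, {x : E | dist x (g i x) ≤ t i}).Nonempty := by
  have hcomm' (i j : Fin n) : Function.Commute (g i : E → E) (g j) := congrFun (hcomm i j)
  suffices h : ∀ s : Finset (Fin n), ∃ x, ∀ i ∈ s, dist x (g i x) ≤ t i by
    obtain ⟨x, hx⟩ := h Finset.univ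
    exact ⟨x, Set.mem_iInter.2 fun i => hx i (Finset.mem_univ i)⟩
  intro s
  induction s using Finset.induction_on with
  | empty => exact ⟨0, by simp⟩
  | insert j s _ ih =>
    obtain ⟨x, hx⟩ := ih
    obtain ⟨p, hp, hpx⟩ := ((g j).convex_setOf_dist_self_le (t j)).exists_mem_forall_dist_map_le
      ((g j).isClosed_setOf_dist_self_le (t j)) (hne j) x
    refine ⟨p, (Finset.forall_mem_insert _ _ _).2
      ⟨hp, fun i hi => (hpx (g i) ?_ ?_).trans (hx i hi)⟩⟩
    · exact AffineIsometryEquiv.mapsTo_setOf_dist_self_le (hcomm' i j) (t j)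
    · refine AffineIsometryEquiv.mapsTo_setOf_dist_self_le (fun y => ?_) (t j)
      exact ((hcomm' i j).semiconj.inverse_left (g i).symm_apply_apply (g i).apply_symm_apply) y
end

section
/- Let E be a finite-dimensional real inner product space and let S be a set of pairwise commuting affine isometric equivalences of E such that every g ∈ S attains the infimum of its displacement function, i.e. there exists y with dist y (g y) = ⨅ z, dist z (g z). Then there exists a point x ∈ E that simultaneously minimizes all displacement functions: for every g ∈ S, dist x (g x) = ⨅ z, dist z (g z). -/
namespace AffineIsometryEquiv

variable {E : Type*} [NormedAddCommGroup E] [InnerProductSpace ℝ E]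

/-- Two points of minimal displacement of an affine isometry are moved by the same vector. -/
lemma sub_eq_sub_of_dist_minimal (g : E ≃ᵃⁱ[ℝ] E) {x y : E}
    (hx : ∀ z, dist x (g x) ≤ dist z (g z)) (hy : ∀ z, dist y (g y) ≤ dist z (g z)) :
    g x - x = g y - y := by
  by_contra hne
  have hxy : ‖g x - x‖ = ‖g y - y‖ := by
    simpa only [dist_eq_norm'] using le_antisymm (hx y) (hy x)
  have hlt := norm_combo_lt_of_ne (a := (1 / 2 : ℝ)) (b := 1 / 2) le_rfl hxy.ge hne
    (by norm_num) (by norm_num) (by norm_num)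
  have hmid : g (midpoint ℝ x y) = midpoint ℝ (g x) (g y) :=
    g.toAffineEquiv.toAffineMap.map_midpoint x y
  have hle := hx (midpoint ℝ x y)
  rw [dist_eq_norm', dist_eq_norm', hmid] at hle
  refine absurd hlt (not_lt.2 (hle.trans_eq ?_))
  congr 1
  simp only [midpoint_eq_smul_add, invOf_eq_inv]
  module

/-- The affine subspace of points translated by the vector `c` by the affine isometry `g`. -/
noncomputable def translationLocus (g : E ≃ᵃⁱ[ℝ] E) (c : E) : AffineSubspace ℝ E :=
  (AffineSubspace.mk' c ⊥).comap ((g.toAffineEquiv : E →ᵃ[ℝ] E) - AffineMap.id ℝ E)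

lemma mem_translationLocus {g : E ≃ᵃⁱ[ℝ] E} {c x : E} :
    x ∈ g.translationLocus c ↔ g x - x = c := by
  simp [translationLocus, AffineSubspace.mem_comap, AffineSubspace.mem_mk', sub_eq_zero]

/-- The displacement of an affine isometry commuting with `h` is invariant under `h`. -/
lemma dist_apply_of_commute {g h : E ≃ᵃⁱ[ℝ] E} (hgh : ∀ x, g (h x) = h (g x)) (x : E) :
    dist (h x) (g (h x)) = dist x (g x) := by
  rw [hgh, h.dist_map]

/-- Orthogonal projection onto an affine subspace invariant under an affine isometry does not
increase the displacement. -/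
lemma dist_orthogonalProjection_le (g : E ≃ᵃⁱ[ℝ] E) (F : AffineSubspace ℝ E) [Nonempty F]
    [F.direction.HasOrthogonalProjection] (hF : ∀ x, g x ∈ F ↔ x ∈ F) (y : E) :
    dist (EuclideanGeometry.orthogonalProjection F y : E)
      (g (EuclideanGeometry.orthogonalProjection F y)) ≤ dist y (g y) := by
  have hmap : F.map g.toAffineIsometry.toAffineMap = F := by
    ext x
    rw [AffineSubspace.mem_map]
    constructor
    · rintro ⟨z, hz, rfl⟩
      exact (hF z).2 hz
    · intro hx
      exact ⟨g.symm x, (hF _).1 (by simpa using hx), g.apply_symm_apply x⟩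
  have hcomm : (EuclideanGeometry.orthogonalProjection F (g y) : E) =
      g (EuclideanGeometry.orthogonalProjection F y) := by
    have : (F.map g.toAffineIsometry.toAffineMap).direction.HasOrthogonalProjection := by
      rwa [hmap]
    rw [← g.coe_toAffineIsometry, ← EuclideanGeometry.orthogonalProjection_map]
    exact EuclideanGeometry.orthogonalProjection_congr hmap.symm rfl
  rw [← hcomm, dist_eq_norm_vsub E, dist_eq_norm_vsub E]
  have h : ((EuclideanGeometry.orthogonalProjection F y : E) -ᵥ
      (EuclideanGeometry.orthogonalProjection F (g y) : E)) =
      (F.direction.orthogonalProjectionOnto (y -ᵥ g y) : E) :=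
    congrArg Subtype.val
      ((EuclideanGeometry.orthogonalProjection F).toAffineMap.linearMap_vsub y (g y)).symm
  rw [h]
  exact F.direction.norm_orthogonalProjectionOnto_apply_le _

end AffineIsometryEquiv

/-- **Common minimal point for commuting semisimple isometries (part (ii)).**
If `S` is a set of pairwise commuting affine isometric equivalences of a
finite-dimensional real inner product space `E`, each of which attains the infimum of
its displacement function, then some point `x ∈ E` simultaneously minimizes all the
displacement functions. -/
theorem exists_common_min_of_commuting {E : Type*} [NormedAddCommGroup E]
    [InnerProductSpace ℝ E] [FiniteDimensional ℝ E] (S : Set (E ≃ᵃⁱ[ℝ] E))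
    (hcomm : ∀ g ∈ S, ∀ g' ∈ S, ((g : E → E) ∘ (g' : E → E)) = ((g' : E → E) ∘ (g : E → E)))
    (hmin : ∀ g ∈ S, ∃ y : E, dist y (g y) = ⨅ z : E, dist z (g z)) :
    ∃ x : E, ∀ g ∈ S, dist x (g x) = ⨅ z : E, dist z (g z) := by
  have hc : ∀ g ∈ S, ∀ h ∈ S, ∀ x, g (h x) = h (g x) := fun g hg h hh x ↦
    congrFun (hcomm g hg h hh) x
  have hbdd (g : E ≃ᵃⁱ[ℝ] E) : BddBelow (Set.range fun z : E ↦ dist z (g z)) :=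
    ⟨0, by rintro _ ⟨z, rfl⟩; exact dist_nonneg⟩
  obtain ⟨F, ⟨hFne, hFinv⟩, hFmin⟩ := exists_minimalFor_of_wellFoundedLT
    (fun F : AffineSubspace ℝ E ↦ (F : Set E).Nonempty ∧ ∀ g ∈ S, ∀ x, g x ∈ F ↔ x ∈ F)
    (fun F ↦ Module.finrank ℝ F.direction) ⟨⊤, by simp⟩
  obtain ⟨x, hx⟩ := hFne
  have : Nonempty F := ⟨⟨x, hx⟩⟩
  refine ⟨x, fun g hg ↦ ?_⟩
  obtain ⟨y, hy⟩ := hmin g hg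
  have hymin (z : E) : dist y (g y) ≤ dist z (g z) := hy.trans_le (ciInf_le (hbdd g) z)
  let p : E := (EuclideanGeometry.orthogonalProjection F y : F)
  have hpF : p ∈ F := EuclideanGeometry.orthogonalProjection_mem y
  have hpmin (z : E) : dist p (g p) ≤ dist z (g z) :=
    (g.dist_orthogonalProjection_le F (hFinv g hg) y).trans (hymin z)
  have hmem (z : E) : z ∈ g.translationLocus (g p - p) ↔ dist z (g z) = dist p (g p) := by
    rw [AffineIsometryEquiv.mem_translationLocus]
    refine ⟨fun h ↦ by rw [dist_eq_norm', dist_eq_norm', h], fun h ↦ ?_⟩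
    exact g.sub_eq_sub_of_dist_minimal (fun w ↦ h.trans_le (hpmin w)) hpmin
  have hinf : (F ⊓ g.translationLocus (g p - p) : AffineSubspace ℝ E) = F := by
    have hle : F ⊓ g.translationLocus (g p - p) ≤ F := inf_le_left
    have hne : ((F ⊓ g.translationLocus (g p - p) : AffineSubspace ℝ E) : Set E).Nonempty :=
      ⟨p, (AffineSubspace.mem_inf_iff _ _ _).2 ⟨hpF, (hmem p).2 rfl⟩⟩
    have hfin := Submodule.finrank_mono (AffineSubspace.direction_le hle)
    refine AffineSubspace.eq_of_direction_eq_of_nonempty_of_le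
      (Submodule.eq_of_le_of_finrank_le (AffineSubspace.direction_le hle)
        (hFmin ⟨hne, fun h hh z ↦ ?_⟩ hfin)) hne hle
    rw [AffineSubspace.mem_inf_iff, AffineSubspace.mem_inf_iff, hFinv h hh, hmem, hmem,
      AffineIsometryEquiv.dist_apply_of_commute (hc g hg h hh)]
  have hxp : dist x (g x) = dist p (g p) :=
    (hmem x).1 ((AffineSubspace.mem_inf_iff _ _ _).1 (hinf.symm ▸ hx)).2
  exact le_antisymm (le_ciInf fun z ↦ hxp.trans_le (hpmin z)) (ciInf_le (hbdd g) x)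
end

section
/- For every n ∈ ℕ there is an integer ν = ν(n) such that for every sequence g₁, …, g_ν of elements of GL_n(ℂ) whose centralizers form an ascending chain C(g₁) ⊆ C(g₂) ⊆ ⋯ ⊆ C(g_ν) in GL_n(ℂ), there exists i < ν with C(g_i) = C(g_{i+1}). -/
/-- A unit lies in a centralizer as soon as it lies in the linear span of that centralizer. -/
theorem Units.mem_centralizer_of_mem_span (K : Type*) {A : Type*} [CommSemiring K] [Semiring A]
    [Algebra K A] {s : Set Aˣ} {h : Aˣ}
    (hh : (h : A) ∈ Submodule.span K (Units.val '' (Subgroup.centralizer s : Set Aˣ))) :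
    h ∈ Subgroup.centralizer s := by
  have hle : Submodule.span K (Units.val '' (Subgroup.centralizer s : Set Aˣ)) ≤
      Subalgebra.toSubmodule (Subalgebra.centralizer K (Units.val '' s)) := by
    rw [Submodule.span_le]
    rintro _ ⟨k, hk, rfl⟩ _ ⟨g, hg, rfl⟩
    exact congrArg Units.val (hk g hg)
  exact fun g hg => Units.ext (hle hh g ⟨g, hg, rfl⟩)

theorem Units.centralizer_eq_of_span_le (K : Type*) {A : Type*} [CommSemiring K] [Semiring A]
    [Algebra K A] {s t : Set Aˣ} (hst : Subgroup.centralizer s ≤ Subgroup.centralizer t)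
    (hspan : Submodule.span K (Units.val '' (Subgroup.centralizer t : Set Aˣ)) ≤
      Submodule.span K (Units.val '' (Subgroup.centralizer s : Set Aˣ))) :
    Subgroup.centralizer s = Subgroup.centralizer t :=
  le_antisymm hst fun h hh =>
    Units.mem_centralizer_of_mem_span K (hspan (Submodule.subset_span ⟨h, hh, rfl⟩))

/-- In the unit group of a finite-dimensional algebra `A`, an ascending chain of more than
`finrank K A + 1` centralizers has a repetition. -/
theorem Units.exists_centralizer_eq_succ (K : Type*) {A : Type*} [Field K] [Ring A] [Algebra K A]
    [FiniteDimensional K A] (s : ℕ → Set Aˣ)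
    (hs : ∀ i ≤ Module.finrank K A,
      Subgroup.centralizer (s i) ≤ Subgroup.centralizer (s (i + 1))) :
    ∃ i ≤ Module.finrank K A,
      Subgroup.centralizer (s i) = Subgroup.centralizer (s (i + 1)) := by
  by_contra! hne
  let V : ℕ → Submodule K A := fun i =>
    Submodule.span K (Units.val '' (Subgroup.centralizer (s i) : Set Aˣ))
  have hV : ∀ i ≤ Module.finrank K A, V i < V (i + 1) := fun i hi =>
    lt_of_le_not_ge (Submodule.span_mono (Set.image_mono (hs i hi)))
      fun h => hne i hi (Units.centralizer_eq_of_span_le K (hs i hi) h)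
  have hrank : ∀ i ≤ Module.finrank K A + 1, i ≤ Module.finrank K (V i) := by
    intro i
    induction i with
    | zero => simp
    | succ i ih =>
      intro hi
      have := Submodule.finrank_lt_finrank_of_lt (hV i (by lia))
      have := ih (by lia)
      lia
  have := hrank _ le_rfl
  have := (V (Module.finrank K A + 1)).finrank_le
  lia

/-- **Bounded length of ascending chains of centralizers in `GL n ℂ`.** For every `n`
there is an integer `ν = ν(n)` such that any ascending chain of centralizers
`C(g₁) ⊆ C(g₂) ⊆ ⋯ ⊆ C(g_ν)` of elements of `GL n ℂ` stabilizes at some step: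
`C(gᵢ) = C(gᵢ₊₁)` for some `i < ν`. -/
theorem centralizer_chain_bounded (n : ℕ) :
    ∃ ν : ℕ, ∀ g : ℕ → GL (Fin n) ℂ,
      (∀ i : ℕ, i + 1 < ν →
        Subgroup.centralizer {g i} ≤ Subgroup.centralizer {g (i + 1)}) →
      ∃ i : ℕ, i + 1 < ν ∧
        Subgroup.centralizer {g i} = Subgroup.centralizer {g (i + 1)} := by
  refine ⟨Module.finrank ℂ (Matrix (Fin n) (Fin n) ℂ) + 2, fun g hg => ?_⟩
  obtain ⟨i, hi, heq⟩ := Units.exists_centralizer_eq_succ ℂ (fun i => {g i})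
    fun i hi => hg i (by lia)
  exact ⟨i, by lia, heq⟩
end
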